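/- With the notation above, if λ < λ_{D,∞} and λ ∉ σ(A_N) ∪ σ(A_D), then the number of negative eigenvalues of the bounded self-adjoint operator R'(λ) := (A_N − λI)⁻¹ − (A_D − λI)⁻¹ on H equals N_N(λ) − N_D(λ). -/

import Mathlib

noncomputable section

open scoped InnerProductSpace

local notation "⟪" x ", " y "⟫" => @inner ℂ _ _ x y

universe u

variable {H H1 : Type u} [NormedAddCommGroup H] [InnerProductSpace ℂ H] [CompleteSpace H]
  [NormedAddCommGroup H1] [InnerProductSpace ℂ H1] [CompleteSpace H1]

/-- `MemA J H0 u f` says that `u` belongs to the domain `H¹_A` of the maximal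
operator `A` (i.e. the functional `v ↦ a[u,v]` on `H0` is `H`-continuous) and
`A u = f`:  `a[u, v] = (f, v)` for all `v ∈ H0`. -/
def MemA (J : H1 →L[ℂ] H) (H0 : Submodule ℂ H1) (u : H1) (f : H) : Prop :=
  ∀ v ∈ H0, ⟪u, (v : H1)⟫ = ⟪f, J v⟫

/-- Glazman/Rayleigh–Ritz description of the counting function
`N_B(λ) = dim χ_{(-∞,λ)}(A_B) H` (`S = H1` for `B = N`, `S = H0` for `B = D`). -/
def countingFn (J : H1 →L[ℂ] H) (S : Submodule ℂ H1) (lam : ℝ) : Cardinal :=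
  ⨆ L : {L : Submodule ℂ H1 //
    L ≤ S ∧ ∀ u ∈ L, u ≠ 0 → ‖u‖ ^ 2 < lam * ‖J u‖ ^ 2}, Module.rank ℂ L.1

/-- The number of negative eigenvalues (with multiplicity) of a bounded
self-adjoint operator `R` on `H`, i.e. `dim χ_{(-∞,0)}(R) H`, via Glazman's
lemma: the supremum of dimensions of subspaces on which `(R x, x) < 0` for
`x ≠ 0`. -/
def negEigCount (R : H →L[ℂ] H) : Cardinal :=
  ⨆ L : {L : Submodule ℂ H // ∀ x ∈ L, x ≠ 0 → (⟪x, R x⟫ : ℂ).re < 0},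
    Module.rank ℂ L.1

theorem spec_aux (R : H →L[ℂ] H) (hR : IsSelfAdjoint R) :
    ∃ N : Submodule ℂ H, IsClosed (N : Set H) ∧
      (∀ x ∈ N, x ≠ 0 → (⟪x, R x⟫ : ℂ).re < 0) ∧
      ∀ x ∈ Nᗮ, 0 ≤ (⟪x, R x⟫ : ℂ).re := by
  have hm : (0 : H →L[ℂ] H) ≤ R⁻ := CFC.negPart_nonneg R
  have hp : (0 : H →L[ℂ] H) ≤ R⁺ := CFC.posPart_nonneg R
  have hp' := (ContinuousLinearMap.nonneg_iff_isPositive _).1 hp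
  set S : H →L[ℂ] H := CFC.sqrt R⁻ with hS
  have hS0 : 0 ≤ S := CFC.sqrt_nonneg _
  have hSp := (ContinuousLinearMap.nonneg_iff_isPositive _).1 hS0
  have hSS : S * S = R⁻ := CFC.sqrt_mul_sqrt_self _ hm
  have hsub : R⁺ - R⁻ = R := CFC.posPart_sub_negPart R hR
  have hmp : R⁻ * R⁺ = 0 := CFC.negPart_mul_posPart R
  have hmx : ∀ x, R⁻ x = S (S x) := fun x => by rw [← hSS]; rfl
  have hRx : ∀ x, R x = R⁺ x - S (S x) := fun x => by
    rw [← hmx]; conv_lhs => rw [← hsub]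
    rfl
  have hSsym : ∀ x y, ⟪S x, y⟫ = ⟪x, S y⟫ := fun x y => hSp.inner_left_eq_inner_right x y
  have hpsym : ∀ x y, ⟪R⁺ x, y⟫ = ⟪x, R⁺ y⟫ := fun x y => hp'.inner_left_eq_inner_right x y
  have hSp0 : ∀ y, S (R⁺ y) = 0 := fun y => by
    have h1 : S (S (R⁺ y)) = 0 := by
      rw [← hmx]; exact congrArg (fun T : H →L[ℂ] H => T y) hmp
    have : ⟪S (R⁺ y), S (R⁺ y)⟫ = 0 := by rw [hSsym, h1, inner_zero_right]
    exact inner_self_eq_zero.1 this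
  have hkc : IsClosed ((LinearMap.ker (S : H →ₗ[ℂ] H) : Submodule ℂ H) : Set H) :=
    ContinuousLinearMap.isClosed_ker S
  refine ⟨(LinearMap.ker (S : H →ₗ[ℂ] H))ᗮ, Submodule.isClosed_orthogonal _, ?_, ?_⟩
  · intro x hx hx0
    have h1 : R⁺ x = 0 := by
      have h2 : R⁺ (R⁺ x) ∈ LinearMap.ker (S : H →ₗ[ℂ] H) := hSp0 _
      have h3 := (Submodule.mem_orthogonal _ _).1 hx _ h2
      rw [hpsym] at h3
      exact inner_self_eq_zero.1 h3
    have hSx : S x ≠ 0 := by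
      intro h
      have h2 : x ∈ LinearMap.ker (S : H →ₗ[ℂ] H) := h
      exact hx0 (inner_self_eq_zero.1 ((Submodule.mem_orthogonal _ _).1 hx _ h2))
    rw [hRx, h1, zero_sub, inner_neg_right, ← hSsym]
    have : 0 < (⟪S x, S x⟫ : ℂ).re := by
      have h : (⟪S x, S x⟫ : ℂ).re = ‖S x‖ ^ 2 := inner_self_eq_norm_sq (𝕜 := ℂ) (S x)
      rw [h]
      exact pow_pos (norm_pos_iff.2 hSx) 2
    simpa using this
  · intro x hx
    haveI : CompleteSpace (LinearMap.ker (S : H →ₗ[ℂ] H)) := hkc.completeSpace_coe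
    rw [Submodule.orthogonal_orthogonal] at hx
    have hx' : S x = 0 := hx
    rw [hRx, hx', map_zero, sub_zero]
    exact hp'.re_inner_nonneg_right x

/-- the shifted form `a[u,v] - λ (u,v)` -/
def bf (J : H1 →L[ℂ] H) (lam : ℝ) (u v : H1) : ℂ := ⟪u, v⟫ - (lam : ℂ) * ⟪J u, J v⟫

theorem bf_add_left (J : H1 →L[ℂ] H) (lam : ℝ) (u u' v : H1) :
    bf J lam (u + u') v = bf J lam u v + bf J lam u' v := by
  simp only [bf, map_add, inner_add_left]; ring

theorem bf_sub_left (J : H1 →L[ℂ] H) (lam : ℝ) (u u' v : H1) :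
    bf J lam (u - u') v = bf J lam u v - bf J lam u' v := by
  simp only [bf, map_sub, inner_sub_left]; ring

theorem bf_add_right (J : H1 →L[ℂ] H) (lam : ℝ) (u v v' : H1) :
    bf J lam u (v + v') = bf J lam u v + bf J lam u v' := by
  simp only [bf, map_add, inner_add_right]; ring

theorem bf_smul_left (J : H1 →L[ℂ] H) (lam : ℝ) (c : ℂ) (u v : H1) :
    bf J lam (c • u) v = (starRingEnd ℂ) c * bf J lam u v := by
  simp only [bf, map_smul, inner_smul_left]; ring

theorem bf_conj (J : H1 →L[ℂ] H) (lam : ℝ) (u v : H1) :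
    (starRingEnd ℂ) (bf J lam u v) = bf J lam v u := by
  simp only [bf, map_sub, map_mul, inner_conj_symm, Complex.conj_ofReal]

theorem bf_self (J : H1 →L[ℂ] H) (lam : ℝ) (u : H1) :
    bf J lam u u = ((‖u‖ ^ 2 - lam * ‖J u‖ ^ 2 : ℝ) : ℂ) := by
  simp only [bf, inner_self_eq_norm_sq_to_K]; push_cast; rfl

theorem bf_self_re (J : H1 →L[ℂ] H) (lam : ℝ) (u : H1) :
    (bf J lam u u).re = ‖u‖ ^ 2 - lam * ‖J u‖ ^ 2 := by
  rw [bf_self, Complex.ofReal_re]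

theorem bf_resolvent (J : H1 →L[ℂ] H) (lam : ℝ) (T : H →L[ℂ] H1) (R : H →L[ℂ] H1)
    (hR : ∀ (f : H) (u : H1), R f = u ↔ T (f + (lam : ℂ) • J u) = u)
    (f : H) (v : H1) (hT : ∀ u : H, ⟪T u, v⟫ = ⟪u, J v⟫) :
    bf J lam (R f) v = ⟪f, J v⟫ := by
  have h := (hR f (R f)).1 rfl
  have h2 := hT (f + (lam : ℂ) • J (R f))
  rw [h] at h2
  rw [bf, h2, inner_add_left, inner_smul_left, Complex.conj_ofReal]; ring

theorem bf_continuous (J : H1 →L[ℂ] H) (lam : ℝ) (v : H1) :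
    Continuous (fun u => bf J lam u v) := by
  unfold bf; fun_prop

theorem bf_self_continuous (J : H1 →L[ℂ] H) (lam : ℝ) :
    Continuous (fun u => (bf J lam u u).re) := by
  unfold bf; fun_prop

theorem le_countingFn (J : H1 →L[ℂ] H) (S : Submodule ℂ H1) (lam : ℝ) (L : Submodule ℂ H1)
    (hL : L ≤ S) (h : ∀ u ∈ L, u ≠ 0 → (bf J lam u u).re < 0) :
    Module.rank ℂ L ≤ countingFn J S lam := by
  refine le_ciSup (f := fun L : {L : Submodule ℂ H1 //
    L ≤ S ∧ ∀ u ∈ L, u ≠ 0 → ‖u‖ ^ 2 < lam * ‖J u‖ ^ 2} => Module.rank ℂ L.1)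
    (Cardinal.bddAbove_range _) ⟨L, hL, fun u hu hu0 => ?_⟩
  have := h u hu hu0
  rw [bf_self_re] at this
  linarith

theorem le_negEigCount (R : H →L[ℂ] H) (L : Submodule ℂ H)
    (h : ∀ x ∈ L, x ≠ 0 → (⟪x, R x⟫ : ℂ).re < 0) :
    Module.rank ℂ L ≤ negEigCount R :=
  le_ciSup (f := fun L : {L : Submodule ℂ H // ∀ x ∈ L, x ≠ 0 → (⟪x, R x⟫ : ℂ).re < 0} =>
    Module.rank ℂ L.1) (Cardinal.bddAbove_range _) ⟨L, h⟩

/- If `λ < λ_{D,∞}` and `λ ∉ σ(A_N) ∪ σ(A_D)` then the number of negative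
eigenvalues of `R'(λ) = (A_N - λ)⁻¹ - (A_D - λ)⁻¹` equals `N_N(λ) - N_D(λ)`.
The resolvents are encoded as bounded operators `RN RD : H → H1` with
`R_B f = u ↔ (A_B - λ) u = f`, i.e. `u = A_B⁻¹ (f + λ u) = T_B (f + λ J u)`;
their existence encodes `λ ∉ σ(A_B)`.  `λ < inf σ_ess(A_D)` is expressed by the
existence of `μ > λ` with `N_D(μ)` finite. -/
theorem stmt14
    (J : H1 →L[ℂ] H) (hJinj : Function.Injective J) (hJdense : DenseRange J)
    (H0 : Submodule ℂ H1) [CompleteSpace H0]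
    (hH0dense : DenseRange (fun v : H0 => J v))
    (TN : H →L[ℂ] H1) (hTN : ∀ (u : H) (v : H1), ⟪TN u, v⟫ = ⟪u, J v⟫)
    (TD : H →L[ℂ] H1) (hTDmem : ∀ u : H, TD u ∈ H0)
    (hTD : ∀ (u : H), ∀ v ∈ H0, ⟪TD u, (v : H1)⟫ = ⟪u, J v⟫)
    (lam : ℝ)
    (hlam : ∃ mu : ℝ, lam < mu ∧ countingFn J H0 mu < Cardinal.aleph0)
    (RN : H →L[ℂ] H1)
    (hRN : ∀ (f : H) (u : H1), RN f = u ↔ TN (f + (lam : ℂ) • J u) = u)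
    (RD : H →L[ℂ] H1)
    (hRD : ∀ (f : H) (u : H1), RD f = u ↔ TD (f + (lam : ℂ) • J u) = u) :
    negEigCount (J.comp (RN - RD)) + countingFn J H0 lam =
      countingFn J (⊤ : Submodule ℂ H1) lam := by
  have bN : ∀ (f : H) (v : H1), bf J lam (RN f) v = ⟪f, J v⟫ := fun f v =>
    bf_resolvent J lam TN RN hRN f v (fun u => hTN u v)
  have bD : ∀ (f : H), ∀ v ∈ H0, bf J lam (RD f) v = ⟪f, J v⟫ := fun f v hv =>
    bf_resolvent J lam TD RD hRD f v (fun u => hTD u v hv)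
  have RDmem : ∀ f, RD f ∈ H0 := fun f => by
    rw [← (hRD f (RD f)).1 rfl]; exact hTDmem _
  set W : H →L[ℂ] H1 := RN - RD with hW
  -- the form-orthogonal complement of H0
  let K : Submodule ℂ H1 :=
    { carrier := {w | ∀ v ∈ H0, bf J lam w v = 0}
      add_mem' := fun {a b} ha hb v hv => by rw [bf_add_left, ha v hv, hb v hv, add_zero]
      zero_mem' := fun v _ => by simp [bf]
      smul_mem' := fun c a ha v hv => by rw [bf_smul_left, ha v hv, mul_zero] }
  have hKc : IsClosed (K : Set H1) := by
    have : (K : Set H1) = ⋂ v ∈ H0, {w | bf J lam w v = 0} := by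
      ext w; simp only [Set.mem_iInter]; rfl
    rw [this]
    exact isClosed_biInter fun v _ => isClosed_eq (bf_continuous J lam v) continuous_const
  have hK : ∀ w ∈ K, ∀ v ∈ H0, bf J lam w v = 0 := fun w hw => hw
  have hK' : ∀ w ∈ K, ∀ v ∈ H0, bf J lam v w = 0 := fun w hw v hv => by
    rw [← bf_conj, hK w hw v hv, map_zero]
  have hWK : ∀ f, W f ∈ K := fun f v hv => by
    show bf J lam (RN f - RD f) v = 0
    rw [bf_sub_left, bN, bD f v hv, sub_self]
  have hWb : ∀ f, ∀ w ∈ K, bf J lam (W f) w = ⟪f, J w⟫ := fun f w hw => by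
    show bf J lam (RN f - RD f) w = _
    rw [bf_sub_left, bN, hK' w hw _ (RDmem f), sub_zero]
  have hq : ∀ f, ⟪f, (J.comp W) f⟫ = bf J lam (W f) (W f) := fun f =>
    (hWb f _ (hWK f)).symm
  have hsum : ∀ v ∈ H0, ∀ w ∈ K,
      bf J lam (v + w) (v + w) = bf J lam v v + bf J lam w w := fun v hv w hw => by
    rw [bf_add_left, bf_add_right, bf_add_right, hK w hw v hv, hK' w hw v hv]; ring
  have hGsa : IsSelfAdjoint (J.comp W) := by
    rw [ContinuousLinearMap.isSelfAdjoint_iff_isSymmetric,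
      LinearMap.isSymmetric_iff_inner_map_self_real]
    intro f
    have h1 : ⟪(J.comp W) f, f⟫ = bf J lam (W f) (W f) := by
      rw [← inner_conj_symm, hq, bf_conj]
    show (starRingEnd ℂ) ⟪(J.comp W) f, f⟫ = ⟪(J.comp W) f, f⟫
    rw [h1, bf_conj]
  apply le_antisymm
  · have hne1 : Nonempty {L : Submodule ℂ H //
        ∀ x ∈ L, x ≠ 0 → (⟪x, (J.comp W) x⟫ : ℂ).re < 0} :=
      ⟨⟨⊥, fun x hx hx0 => absurd ((Submodule.mem_bot ℂ).1 hx) hx0⟩⟩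
    have hne2 : Nonempty {L : Submodule ℂ H1 //
        L ≤ H0 ∧ ∀ u ∈ L, u ≠ 0 → ‖u‖ ^ 2 < lam * ‖J u‖ ^ 2} :=
      ⟨⟨⊥, bot_le, fun x hx hx0 => absurd ((Submodule.mem_bot ℂ).1 hx) hx0⟩⟩
    rw [negEigCount, countingFn, Cardinal.ciSup_add_ciSup _ (Cardinal.bddAbove_range _) _ (Cardinal.bddAbove_range _)]
    refine ciSup_le' fun L => ciSup_le' fun L0 => ?_
    obtain ⟨L, hL⟩ := L
    obtain ⟨L0, hL0, hL0n⟩ := L0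
    have hL0n' : ∀ u ∈ L0, u ≠ 0 → (bf J lam u u).re < 0 := fun u hu hu0 => by
      rw [bf_self_re]; linarith [hL0n u hu hu0]
    have hLn : ∀ f ∈ L, f ≠ 0 → (bf J lam (W f) (W f)).re < 0 := fun f hf hf0 => by
      rw [← hq]; exact hL f hf hf0
    let Φ : (L × L0) →ₗ[ℂ] H1 :=
      LinearMap.coprod ((W : H →ₗ[ℂ] H1).comp L.subtype) L0.subtype
    have hΦ : ∀ p, Φ p = (p.2 : H1) + W p.1 := fun p => add_comm _ _
    have key : ∀ p, p ≠ 0 → (bf J lam (Φ p) (Φ p)).re < 0 := by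
      rintro ⟨f, v⟩ hp
      rw [hΦ, hsum _ (hL0 v.2) _ (hWK _), Complex.add_re]
      by_cases hf : f = 0
      · have hv : (v : H1) ≠ 0 := fun h => hp (by
          rw [Prod.mk_eq_zero]; exact ⟨hf, Subtype.ext h⟩)
        have := hL0n' v v.2 hv
        simp only [hf]
        simpa [bf] using this
      · have h1 := hLn f f.2 (fun h => hf (Subtype.ext h))
        by_cases hv : (v : H1) = 0
        · simp only [hv]
          simpa [bf] using h1
        · have := hL0n' v v.2 hv
          exact add_neg this h1
    have hinj : Function.Injective Φ := by
      rw [injective_iff_map_eq_zero]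
      intro p hp
      by_contra h
      have := key p h
      rw [hp] at this
      simp [bf] at this
    have h1 : Module.rank ℂ L + Module.rank ℂ L0 = Module.rank ℂ (LinearMap.range Φ) := by
      rw [rank_range_of_injective Φ hinj, rank_prod']
    show Module.rank ℂ L + Module.rank ℂ L0 ≤ _
    rw [h1]
    refine le_countingFn J ⊤ lam _ le_top ?_
    rintro _ ⟨p, rfl⟩ hp
    exact key p (fun h => hp (by rw [h, map_zero]))
  · refine ciSup_le' ?_
    rintro ⟨M, -, hM⟩
    show Module.rank ℂ M ≤ _
    have hM' : ∀ u ∈ M, u ≠ 0 → (bf J lam u u).re < 0 := fun u hu hu0 => by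
      rw [bf_self_re]; linarith [hM u hu hu0]
    -- Riesz operator of the form
    let G : H1 →L[ℂ] H1 := ContinuousLinearMap.id ℂ H1 - (lam : ℂ) • TN.comp J
    have hG : ∀ u v, ⟪G u, v⟫ = bf J lam u v := fun u v => by
      show ⟪u - (lam : ℂ) • TN (J u), v⟫ = _
      rw [inner_sub_left, inner_smul_left, hTN, Complex.conj_ofReal, bf]
    let P : H1 →L[ℂ] H0 := H0.orthogonalProjectionOnto
    have hP : ∀ u, ∀ v : H0, ⟪(P u : H1), (v : H1)⟫ = ⟪u, (v : H1)⟫ := fun u v => by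
      have h := Submodule.starProjection_inner_eq_zero (K := H0) u v v.2
      rw [inner_sub_left, sub_eq_zero] at h
      exact h.symm
    -- decomposition
    let D : H1 →L[ℂ] H1 :=
      (ContinuousLinearMap.id ℂ H1 + (lam : ℂ) • RD.comp J).comp (H0.subtypeL.comp (P.comp G))
    have hDx : ∀ u, D u = (P (G u) : H1) + (lam : ℂ) • RD (J (P (G u))) := fun u => rfl
    have hDmem : ∀ u, D u ∈ H0 := fun u => by
      rw [hDx]; exact H0.add_mem (P (G u)).2 (H0.smul_mem _ (RDmem _))
    have hDK : ∀ u, u - D u ∈ K := fun u v hv => by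
      rw [bf_sub_left, hDx, bf_add_left, bf_smul_left, bD _ v hv, Complex.conj_ofReal,
        ← hG u v, ← hP (G u) ⟨v, hv⟩, bf]
      ring
    -- spectral subspace in H0
    let G0 : H0 →L[ℂ] H0 := P.comp (G.comp H0.subtypeL)
    have hG0 : ∀ u v : H0, ⟪G0 u, v⟫ = bf J lam u v := fun u v => by
      rw [← hG, ← hP]; rfl
    have hG0' : ∀ u : H0, ⟪u, G0 u⟫ = bf J lam u u := fun u => by
      rw [← inner_conj_symm, hG0, bf_conj]
    have hG0sa : IsSelfAdjoint G0 := by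
      rw [ContinuousLinearMap.isSelfAdjoint_iff_isSymmetric]
      intro u v
      show ⟪G0 u, v⟫ = ⟪u, G0 v⟫
      rw [← inner_conj_symm u, hG0, hG0, bf_conj]
    obtain ⟨N0, hN0c, hN0neg, hN0pos⟩ := spec_aux G0 hG0sa
    obtain ⟨N, hNc, hNneg, hNpos⟩ := spec_aux (J.comp W) hGsa
    haveI : CompleteSpace N0 := hN0c.completeSpace_coe
    haveI : CompleteSpace N := hNc.completeSpace_coe
    let P1 : Submodule ℂ H1 := (Nᗮ.map (W : H →ₗ[ℂ] H1)).topologicalClosure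
    have hP1c : IsClosed (P1 : Set H1) := Submodule.isClosed_topologicalClosure _
    haveI : CompleteSpace P1 := hP1c.completeSpace_coe
    have hWP1 : ∀ f ∈ Nᗮ, W f ∈ P1 := fun f hf =>
      Submodule.le_topologicalClosure _ ⟨f, hf, rfl⟩
    have hP1K : P1 ≤ K := Submodule.topologicalClosure_minimal _ (by
      rintro _ ⟨f, -, rfl⟩; exact hWK f) hKc
    have hP1pos : ∀ w ∈ P1, 0 ≤ (bf J lam w w).re := by
      have hcl : IsClosed {w | 0 ≤ (bf J lam w w).re} :=
        isClosed_le continuous_const (bf_self_continuous J lam)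
      have hsub : ((Nᗮ.map (W : H →ₗ[ℂ] H1) : Submodule ℂ H1) : Set H1) ⊆
          {w | 0 ≤ (bf J lam w w).re} := by
        rintro _ ⟨f, hf, rfl⟩
        have := hNpos f hf
        rw [hq] at this
        exact this
      intro w hw
      exact closure_minimal hsub hcl hw
    -- injectivity of the adjoint of W on K
    have hWinj : ∀ w ∈ K, ContinuousLinearMap.adjoint W w = 0 → w = 0 := by
      intro w hw h0
      have horth : ∀ f, ⟪w, W f⟫ = 0 := fun f => by
        rw [← ContinuousLinearMap.adjoint_inner_left, h0, inner_zero_left]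
      let u : H1 := w + (lam : ℂ) • RN (J w)
      have hu : ∀ v, bf J lam u v = ⟪w, v⟫ := fun v => by
        show bf J lam (w + (lam : ℂ) • RN (J w)) v = _
        rw [bf_add_left, bf_smul_left, bN, Complex.conj_ofReal, bf]; ring
      have huk : ∀ v ∈ K, bf J lam (u - D u) v = ⟪w, v⟫ := fun v hv => by
        rw [bf_sub_left, hu, hK' v hv _ (hDmem u), sub_zero]
      have hk : ∀ f, ⟪f, J (u - D u)⟫ = 0 := fun f => by
        rw [← hWb f _ (hDK u), ← bf_conj, huk _ (hWK f), horth, map_zero]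
      have hJ : J (u - D u) = 0 := inner_self_eq_zero.1 (hk _)
      have hz : u - D u = 0 := hJinj (by rw [hJ, map_zero])
      have := huk w hw
      rw [hz] at this
      refine (inner_self_eq_zero (𝕜 := ℂ)).1 ?_
      rw [← this]; simp [bf]
    have hadj : ∀ r ∈ P1ᗮ, ContinuousLinearMap.adjoint W r ∈ N := fun r hr => by
      rw [← Submodule.orthogonal_orthogonal N, Submodule.mem_orthogonal]
      intro f hf
      rw [ContinuousLinearMap.adjoint_inner_right]
      exact (Submodule.mem_orthogonal _ _).1 hr _ (hWP1 f hf)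
    let E : H1 →L[ℂ] H1 := ContinuousLinearMap.id ℂ H1 - D
    let Q : H1 →L[ℂ] H1 := ContinuousLinearMap.id ℂ H1 - P1.starProjection
    have hQ : ∀ w, Q w ∈ P1ᗮ := fun w => Submodule.sub_starProjection_mem_orthogonal w
    let A1 : M →ₗ[ℂ] N := LinearMap.codRestrict N
      ((((ContinuousLinearMap.adjoint W).comp (Q.comp E)) : H1 →ₗ[ℂ] H).comp M.subtype)
      (fun u => hadj _ (hQ _))
    let D0 : H1 →ₗ[ℂ] H0 := LinearMap.codRestrict H0 (D : H1 →ₗ[ℂ] H1) hDmem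
    let A0 : M →ₗ[ℂ] N0 :=
      ((N0.orthogonalProjectionOnto : H0 →L[ℂ] N0) : H0 →ₗ[ℂ] N0).comp (D0.comp M.subtype)
    have hinj : Function.Injective (A1.prod A0) := by
      rw [injective_iff_map_eq_zero]
      rintro ⟨u, hu⟩ h
      have h1 : ContinuousLinearMap.adjoint W (Q (E u)) = 0 :=
        congrArg (fun p : N × N0 => (p.1 : H)) h
      have h0 : N0.starProjection (D0 u) = 0 :=
        congrArg (fun p : N × N0 => (p.2 : H0)) h
      have hEK : E u ∈ K := hDK u
      have hQK : Q (E u) ∈ K :=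
        K.sub_mem hEK (hP1K (Submodule.starProjection_apply_mem _ _))
      have hQ0 : E u - P1.starProjection (E u) = 0 := hWinj _ hQK h1
      have hEP : E u ∈ P1 := by
        rw [sub_eq_zero.1 hQ0]; exact Submodule.starProjection_apply_mem _ _
      have hD0 : D0 u ∈ N0ᗮ := (Submodule.starProjection_apply_eq_zero_iff _).1 h0
      have hpos0 := hN0pos _ hD0
      rw [hG0'] at hpos0
      have hpos1 := hP1pos _ hEP
      have hdec : u = D u + E u := by
        show u = D u + (u - D u)
        abel
      by_contra hne
      have hneg := hM' u hu (fun h => hne (Subtype.ext h))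
      rw [hdec, hsum _ (hDmem u) _ hEK, Complex.add_re] at hneg
      have : 0 ≤ (bf J lam (D u) (D u)).re := hpos0
      linarith
    calc Module.rank ℂ M ≤ Module.rank ℂ (N × N0) := LinearMap.rank_le_of_injective _ hinj
      _ = Module.rank ℂ N + Module.rank ℂ N0 := rank_prod'
      _ ≤ _ := by
        refine add_le_add (le_negEigCount _ N hNneg) ?_
        have h1 : Module.rank ℂ N0 = Module.rank ℂ (N0.map H0.subtype) :=
          (LinearEquiv.rank_eq (Submodule.equivMapOfInjective H0.subtype
            H0.injective_subtype N0))
        rw [h1]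
        refine le_countingFn J H0 lam _ (Submodule.map_subtype_le _ _) ?_
        rintro _ ⟨v, hv, rfl⟩ hv0
        have := hN0neg v hv (fun h => hv0 (by rw [h, map_zero]))
        rw [hG0'] at this
        exact this

end
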